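/- arXiv:2511.18562 — 4 statements merged into one kernel-verified Lean document; each statement's English description precedes it below -/
import Mathlib

section
/- Let (f,g) be a random vector in ℝ² on a probability space with a joint density p(u,v) with respect to Lebesgue measure, with g ≥ 0 almost surely and E[g] < ∞. Fix α ∈ (0,1). Let f_f denote the marginal Lebesgue density of f, and let q₀ := Q_{1−α}(f). Assume: (i) f_f is continuous and strictly positive at q₀, so that the CDF of f is differentiable at q₀ with derivative f_f(q₀) > 0; (ii) the function m(x) := (1/f_f(x)) ∫_ℝ v·p(x,v) dv is well defined on a neighborhood of q₀ and continuous at q₀; (iii) p is continuous on a neighborhood of {q₀} × ℝ and there exist η > 0 and an integrable dominating bound ∫_ℝ sup_{|s−q₀|≤η} (1+|v|)·p(s,v) dv < ∞, so that differentiation under the integral sign of ε ↦ P(f − εg ≤ x) is valid for x near q₀; (iv) for every sufficiently small ε ≥ 0 the quantile q(ε) := Q_{1−α}(f − εg) satisfies P(f − εg ≤ q(ε)) = 1−α, and q(ε) → q₀ as ε → 0⁺. Then, as ε → 0⁺, q(ε) = q₀ − ε·m(q₀) + o(ε); that is, Q_{1−α}(f − εg) = Q_{1−α}(f) − ε·E[g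 | f = q₀] + o(ε). -/
open MeasureTheory Set Filter Asymptotics

/-- The `p`-quantile of a real random variable `W` under the probability measure `μ`:
`Q_p(W) := inf {t : ℝ | P(W ≤ t) ≥ p}`. -/
noncomputable def quantile {Ω : Type*} [MeasurableSpace Ω] (μ : Measure Ω) (W : Ω → ℝ)
    (p : ℝ) : ℝ :=
  sInf {t : ℝ | p ≤ (μ {ω | W ω ≤ t}).toReal}

open scoped Topology

/-- Tail estimate: `P(ε g > δ) = o(ε)` for integrable `g`. -/
lemma qs_tail {Ω : Type*} [MeasurableSpace Ω] (μ : Measure Ω) [IsProbabilityMeasure μ]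
    (g : Ω → ℝ) (hg : Measurable g) (hg_int : Integrable g μ) (δ : ℝ) (hδ : 0 < δ) :
    Tendsto (fun ε : ℝ => μ.real {ω | δ < ε * g ω} / ε) (𝓝[>] 0) (𝓝 0) := by
  have key : Tendsto (fun ε : ℝ => ∫ ω, ({ω | δ < ε * g ω}.indicator (fun _ => 1 / ε) ω) ∂μ)
      (𝓝[>] 0) (𝓝 (∫ _, (0:ℝ) ∂μ)) := by
    refine tendsto_integral_filter_of_dominated_convergence (fun ω => |g ω| / δ) ?_ ?_ ?_ ?_
    · refine Eventually.of_forall fun ε => ?_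
      have hs : MeasurableSet {ω | δ < ε * g ω} :=
        measurableSet_lt measurable_const (hg.const_mul ε)
      exact (measurable_const.indicator hs).aestronglyMeasurable
    · filter_upwards [self_mem_nhdsWithin] with ε hε
      have hε : 0 < ε := hε
      refine Eventually.of_forall fun ω => ?_
      by_cases h : δ < ε * g ω
      · rw [indicator_of_mem (by exact h)]
        rw [Real.norm_of_nonneg (by positivity), div_le_div_iff₀ hε hδ]
        nlinarith [le_abs_self (g ω)]
      · rw [indicator_of_notMem (by exact h)]
        simp; positivity
    · exact hg_int.abs.div_const δ
    · refine Eventually.of_forall fun ω => ?_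
      have h1 : Tendsto (fun ε : ℝ => ε * g ω) (𝓝[>] 0) (𝓝 0) := by
        have : Tendsto (fun ε : ℝ => ε * g ω) (𝓝 0) (𝓝 (0 * g ω)) :=
          (continuous_id.mul continuous_const).tendsto 0
        rw [zero_mul] at this
        exact this.mono_left nhdsWithin_le_nhds
      refine tendsto_const_nhds.congr' ?_
      filter_upwards [h1.eventually (gt_mem_nhds hδ)] with ε hε
      rw [indicator_of_notMem]
      simp only [mem_ofPred_eq, not_lt]; exact hε.le
  simp only [integral_zero] at key
  refine key.congr fun ε => ?_
  have hs : MeasurableSet {ω | δ < ε * g ω} :=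
    measurableSet_lt measurable_const (hg.const_mul ε)
  rw [integral_indicator_const _ hs]
  simp [div_eq_mul_inv]

/-- Mass of a measurable set under the joint law. -/
lemma qs_mass {Ω : Type*} [MeasurableSpace Ω] (μ : Measure Ω)
    [IsProbabilityMeasure μ] (f g : Ω → ℝ) (hf : Measurable f) (hg : Measurable g)
    (p : ℝ × ℝ → ℝ) (hp_meas : Measurable p) (hp_nonneg : ∀ uv, 0 ≤ p uv)
    (hdensity : Measure.map (fun ω => (f ω, g ω)) μ =
      (volume : Measure (ℝ × ℝ)).withDensity fun uv => ENNReal.ofReal (p uv))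
    (A : Set (ℝ × ℝ)) (hA : MeasurableSet A) :
    μ {ω | (f ω, g ω) ∈ A} = ∫⁻ uv in A, ENNReal.ofReal (p uv) := by
  rw [← withDensity_apply _ hA, ← hdensity, Measure.map_apply (hf.prodMk hg) hA]
  rfl

lemma qs_integrable {Ω : Type*} [MeasurableSpace Ω] (μ : Measure Ω)
    [IsProbabilityMeasure μ] (f g : Ω → ℝ) (hf : Measurable f) (hg : Measurable g)
    (p : ℝ × ℝ → ℝ) (hp_meas : Measurable p) (hp_nonneg : ∀ uv, 0 ≤ p uv)
    (hdensity : Measure.map (fun ω => (f ω, g ω)) μ =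
      (volume : Measure (ℝ × ℝ)).withDensity fun uv => ENNReal.ofReal (p uv)) :
    Integrable p := by
  refine ⟨hp_meas.aestronglyMeasurable, ?_⟩
  rw [hasFiniteIntegral_iff_ofReal (Eventually.of_forall hp_nonneg)]
  have := qs_mass μ f g hf hg p hp_meas hp_nonneg hdensity univ MeasurableSet.univ
  rw [Measure.restrict_univ] at this
  rw [← this]
  exact measure_lt_top _ _

lemma qs_mass_real {Ω : Type*} [MeasurableSpace Ω] (μ : Measure Ω)
    [IsProbabilityMeasure μ] (f g : Ω → ℝ) (hf : Measurable f) (hg : Measurable g)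
    (p : ℝ × ℝ → ℝ) (hp_meas : Measurable p) (hp_nonneg : ∀ uv, 0 ≤ p uv)
    (hdensity : Measure.map (fun ω => (f ω, g ω)) μ =
      (volume : Measure (ℝ × ℝ)).withDensity fun uv => ENNReal.ofReal (p uv))
    (A : Set (ℝ × ℝ)) (hA : MeasurableSet A) :
    μ.real {ω | (f ω, g ω) ∈ A} = ∫ uv in A, p uv := by
  rw [integral_eq_lintegral_of_nonneg_ae (Eventually.of_forall hp_nonneg)
    hp_meas.aestronglyMeasurable,
    ← qs_mass μ f g hf hg p hp_meas hp_nonneg hdensity A hA]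
  rfl

/-- The density vanishes on `v < 0` near `q₀`. -/
lemma qs_zero {Ω : Type*} [MeasurableSpace Ω] (μ : Measure Ω)
    [IsProbabilityMeasure μ] (f g : Ω → ℝ) (hf : Measurable f) (hg : Measurable g)
    (p : ℝ × ℝ → ℝ) (hp_meas : Measurable p) (hp_nonneg : ∀ uv, 0 ≤ p uv)
    (hdensity : Measure.map (fun ω => (f ω, g ω)) μ =
      (volume : Measure (ℝ × ℝ)).withDensity fun uv => ENNReal.ofReal (p uv))
    (hg_nonneg : ∀ᵐ ω ∂μ, 0 ≤ g ω) (q₀ η : ℝ) (hη : 0 < η)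
    (hp_cont : ContinuousOn p (Icc (q₀ - η) (q₀ + η) ×ˢ (univ : Set ℝ)))
    (v : ℝ) (hv : v < 0) : p (q₀, v) = 0 := by
  have hUo : IsOpen (Ioo (q₀ - η) (q₀ + η) ×ˢ Iio (0:ℝ)) := isOpen_Ioo.prod isOpen_Iio
  have h0 : ∫⁻ uv in Ioo (q₀ - η) (q₀ + η) ×ˢ Iio (0:ℝ), ENNReal.ofReal (p uv) = 0 := by
    rw [← qs_mass μ f g hf hg p hp_meas hp_nonneg hdensity _ hUo.measurableSet]
    refine measure_mono_null ?_ hg_nonneg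
    intro ω hω
    have := hω.2
    simpa using this
  rw [lintegral_eq_zero_iff hp_meas.ennreal_ofReal] at h0
  have h1 : p =ᵐ[volume.restrict (Ioo (q₀ - η) (q₀ + η) ×ˢ Iio (0:ℝ))] fun _ => 0 := by
    filter_upwards [h0] with x hx
    exact le_antisymm (by simpa using hx) (hp_nonneg x)
  exact Measure.eqOn_open_of_ae_eq h1 hUo
    (hp_cont.mono (prod_mono Ioo_subset_Icc_self (subset_univ _))) continuousOn_const
    (show (q₀, v) ∈ _ from ⟨⟨by linarith, by linarith⟩, hv⟩)

lemma qs_main {Ω : Type*} [MeasurableSpace Ω] (μ : Measure Ω)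
    [IsProbabilityMeasure μ] (f g : Ω → ℝ) (hf : Measurable f) (hg : Measurable g)
    (p : ℝ × ℝ → ℝ) (hp_meas : Measurable p) (hp_nonneg : ∀ uv, 0 ≤ p uv)
    (hdensity : Measure.map (fun ω => (f ω, g ω)) μ =
      (volume : Measure (ℝ × ℝ)).withDensity fun uv => ENNReal.ofReal (p uv))
    (hg_nonneg : ∀ᵐ ω ∂μ, 0 ≤ g ω) (q₀ η : ℝ) (hη : 0 < η)
    (hp_cont : ContinuousOn p (Icc (q₀ - η) (q₀ + η) ×ˢ (univ : Set ℝ)))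
    (B : ℝ → ℝ) (hB_int : Integrable B)
    (hB : ∀ s : ℝ, |s - q₀| ≤ η → ∀ v : ℝ, (1 + |v|) * p (s, v) ≤ B v)
    (q : ℝ → ℝ) (hq_tendsto : Tendsto q (𝓝[>] 0) (𝓝 q₀)) :
    Tendsto (fun ε : ℝ => μ.real {ω | q ε < f ω ∧ f ω ≤ q ε + ε * g ω ∧ ε * g ω ≤ η / 2} / ε)
      (𝓝[>] 0) (𝓝 (∫ v, v * p (q₀, v))) := by
  have hpi := qs_integrable μ f g hf hg p hp_meas hp_nonneg hdensity
  set A : ℝ → Set (ℝ × ℝ) := fun ε =>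
    {x | q ε < x.1 ∧ x.1 ≤ q ε + ε * x.2 ∧ ε * x.2 ≤ η / 2} with hAdef
  have hA : ∀ ε, MeasurableSet (A ε) := fun ε => by
    have a1 : MeasurableSet {x : ℝ × ℝ | q ε < x.1} :=
      measurableSet_lt measurable_const measurable_fst
    have a2 : MeasurableSet {x : ℝ × ℝ | x.1 ≤ q ε + ε * x.2} :=
      measurableSet_le measurable_fst (by fun_prop)
    have a3 : MeasurableSet {x : ℝ × ℝ | ε * x.2 ≤ η / 2} :=
      measurableSet_le (by fun_prop) measurable_const
    exact a1.inter (a2.inter a3)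
  have hi : ∀ ε, Integrable ((A ε).indicator p) ((volume : Measure ℝ).prod volume) :=
    fun ε => hpi.indicator (hA ε)
  have hint : ∀ ε, μ.real {ω | q ε < f ω ∧ f ω ≤ q ε + ε * g ω ∧ ε * g ω ≤ η / 2} / ε
      = ∫ v, (∫ u, (A ε).indicator p (u, v)) / ε := by
    intro ε
    have h := qs_mass_real μ f g hf hg p hp_meas hp_nonneg hdensity (A ε) (hA ε)
    rw [integral_div, ← integral_prod_symm _ (hi ε), integral_indicator (hA ε)]
    congr 1
  have hslice : ∀ ε v, ε * v ≤ η / 2 →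
      ∫ u, (A ε).indicator p (u, v) = ∫ u in Ioc (q ε) (q ε + ε * v), p (u, v) := by
    intro ε v h
    rw [← integral_indicator measurableSet_Ioc]
    congr 1
    ext u
    by_cases hu : u ∈ Ioc (q ε) (q ε + ε * v)
    · rw [indicator_of_mem hu, indicator_of_mem]
      exact ⟨hu.1, hu.2, h⟩
    · rw [indicator_of_notMem hu, indicator_of_notMem]
      exact fun h' => hu ⟨h'.1, h'.2.1⟩
  have hslice' : ∀ ε v, ¬ ε * v ≤ η / 2 → ∫ u, (A ε).indicator p (u, v) = 0 := by
    intro ε v h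
    have : ∀ u, (A ε).indicator p (u, v) = 0 := fun u =>
      indicator_of_notMem (fun h' => h h'.2.2) _
    simp [this]
  have hB0 : ∀ v, 0 ≤ B v := fun v =>
    (mul_nonneg (by positivity) (hp_nonneg (q₀, v))).trans (hB q₀ (by simp [hη.le]) v)
  simp_rw [hint]
  refine tendsto_integral_filter_of_dominated_convergence B ?_ ?_ hB_int ?_
  · refine Eventually.of_forall fun ε => ?_
    exact ((hi ε).integral_prod_right.div_const ε).aestronglyMeasurable
  · filter_upwards [self_mem_nhdsWithin,
      hq_tendsto.eventually (Metric.ball_mem_nhds q₀ (half_pos hη))] with ε hε hqε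
    have hε : 0 < ε := hε
    rw [Real.dist_eq, abs_lt] at hqε
    refine Eventually.of_forall fun v => ?_
    by_cases h : ε * v ≤ η / 2
    · rw [hslice ε v h]
      rcases le_or_gt v 0 with hv | hv
      · rw [Ioc_eq_empty (by nlinarith)]
        simpa using hB0 v
      · have hb : ‖∫ u in Ioc (q ε) (q ε + ε * v), p (u, v)‖
            ≤ (B v / (1 + |v|)) * volume.real (Ioc (q ε) (q ε + ε * v)) := by
          refine norm_setIntegral_le_of_norm_le_const (by simp) ?_
          intro u hu
          rw [Real.norm_of_nonneg (hp_nonneg _), le_div_iff₀ (by positivity), mul_comm]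
          exact hB u (abs_le.2 ⟨by linarith [hu.1], by linarith [hu.2]⟩) v
        have hvol : volume.real (Ioc (q ε) (q ε + ε * v)) = ε * v := by
          rw [Real.volume_real_Ioc_of_le (by nlinarith)]; ring
        rw [hvol] at hb
        rw [norm_div, Real.norm_of_nonneg hε.le, div_le_iff₀ hε]
        refine hb.trans ?_
        rw [div_mul_eq_mul_div, div_le_iff₀ (by positivity), abs_of_pos hv]
        nlinarith [mul_nonneg (hB0 v) hε.le]
    · rw [hslice' ε v h]
      simpa using hB0 v
  · refine Eventually.of_forall fun v => ?_
    rcases lt_or_ge v 0 with hv | hv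
    · rw [qs_zero μ f g hf hg p hp_meas hp_nonneg hdensity hg_nonneg q₀ η hη hp_cont v hv]
      rw [mul_zero]
      refine tendsto_const_nhds.congr' ?_
      filter_upwards [self_mem_nhdsWithin] with ε hε
      have hε : 0 < ε := hε
      rw [hslice ε v (by nlinarith), Ioc_eq_empty (by nlinarith)]
      simp
    · have h1 : Tendsto (fun ε : ℝ => ε * v) (𝓝[>] 0) (𝓝 0) := by
        have : Tendsto (fun ε : ℝ => ε * v) (𝓝 0) (𝓝 (0 * v)) :=
          (continuous_id.mul continuous_const).tendsto 0
        rw [zero_mul] at this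
        exact this.mono_left nhdsWithin_le_nhds
      have h2 : Tendsto (fun ε : ℝ => q ε + ε * v) (𝓝[>] 0) (𝓝 q₀) := by
        simpa using hq_tendsto.add h1
      have hc : ContinuousAt (fun u => p (u, v)) q₀ := by
        have : ContinuousAt p (q₀, v) := hp_cont.continuousAt
          (prod_mem_nhds (Icc_mem_nhds (by linarith) (by linarith)) univ_mem)
        exact ContinuousAt.comp (f := fun u : ℝ => (u, v)) this (by fun_prop)
      have hsm : StronglyMeasurableAtFilter (fun u => p (u, v)) (𝓝 q₀) volume :=
        (hp_meas.comp measurable_prodMk_right).stronglyMeasurable.stronglyMeasurableAtFilter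
      have ho := intervalIntegral.integral_sub_linear_isLittleO_of_tendsto_ae (a := q₀)
        hsm (hc.tendsto.mono_left inf_le_left) hq_tendsto h2
      have ho' : (fun ε : ℝ => (∫ u in (q ε)..(q ε + ε * v), p (u, v)) - (ε * v) * p (q₀, v))
          =o[𝓝[>] 0] fun ε : ℝ => ε := by
        refine IsLittleO.trans_isBigO (ho.congr_left fun ε => ?_) ?_
        · simp
        · refine IsBigO.of_bound |v| (Eventually.of_forall fun ε => ?_)
          simp [mul_comm]
      have h3 := ho'.tendsto_div_nhds_zero.add_const (v * p (q₀, v))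
      rw [zero_add] at h3
      refine h3.congr' ?_
      filter_upwards [self_mem_nhdsWithin, h1.eventually (gt_mem_nhds (half_pos hη))]
        with ε hε hε2
      have hε : 0 < ε := hε
      rw [hslice ε v hε2.le, intervalIntegral.integral_of_le (by nlinarith)]
      field_simp
      ring

theorem quantile_shift_expansion {Ω : Type*} [MeasurableSpace Ω] (μ : Measure Ω)
    [IsProbabilityMeasure μ] (f g : Ω → ℝ) (hf : Measurable f) (hg : Measurable g)
    (p : ℝ × ℝ → ℝ) (hp_meas : Measurable p) (hp_nonneg : ∀ uv, 0 ≤ p uv)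
    (hdensity : Measure.map (fun ω => (f ω, g ω)) μ =
      (volume : Measure (ℝ × ℝ)).withDensity fun uv => ENNReal.ofReal (p uv))
    (hg_nonneg : ∀ᵐ ω ∂μ, 0 ≤ g ω) (hg_int : Integrable g μ)
    (α : ℝ) (hα : α ∈ Ioo (0 : ℝ) 1)
    (ff : ℝ → ℝ) (hff : ∀ x, ff x = ∫ v, p (x, v))
    (q₀ : ℝ) (hq₀ : q₀ = quantile μ f (1 - α))
    -- (i) the marginal density is continuous and positive at `q₀`, and the CDF of `f`
    -- is differentiable at `q₀` with derivative `f_f(q₀)`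
    (hff_cont : ContinuousAt ff q₀) (hff_pos : 0 < ff q₀)
    (hcdf_deriv : HasDerivAt (fun x => (μ {ω | f ω ≤ x}).toReal) (ff q₀) q₀)
    -- (ii) the conditional mean `m(x) = (1/f_f(x)) ∫ v·p(x,v) dv` is well defined near `q₀`
    -- and continuous at `q₀`
    (m : ℝ → ℝ) (hm : ∀ᶠ x in nhds q₀, ff x ≠ 0 ∧ m x = (∫ v, v * p (x, v)) / ff x)
    (hm_cont : ContinuousAt m q₀)
    -- (iii) continuity of `p` near `{q₀} × ℝ` and an integrable dominating bound, validating
    -- differentiation under the integral sign of `ε ↦ P(f − εg ≤ x)` for `x` near `q₀`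
    (η : ℝ) (hη : 0 < η)
    (hp_cont : ContinuousOn p (Icc (q₀ - η) (q₀ + η) ×ˢ (univ : Set ℝ)))
    (B : ℝ → ℝ) (hB_int : Integrable B)
    (hB : ∀ s : ℝ, |s - q₀| ≤ η → ∀ v : ℝ, (1 + |v|) * p (s, v) ≤ B v)
    -- (iv) the quantiles `q(ε)` attain the level `1 − α` exactly for small `ε ≥ 0`, and
    -- `q(ε) → q₀` as `ε → 0⁺`
    (q : ℝ → ℝ) (hq : ∀ ε, q ε = quantile μ (fun ω => f ω - ε * g ω) (1 - α))
    (ε₀ : ℝ) (hε₀ : 0 < ε₀)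
    (hlevel : ∀ ε ∈ Icc (0 : ℝ) ε₀, (μ {ω | f ω - ε * g ω ≤ q ε}).toReal = 1 - α)
    (hq_tendsto : Tendsto q (nhdsWithin 0 (Ioi 0)) (nhds q₀)) :
    (fun ε : ℝ => q ε - (q₀ - ε * m q₀)) =o[nhdsWithin 0 (Ioi 0)] fun ε : ℝ => ε := by
  obtain ⟨-, hm0⟩ := hm.self_of_nhds
  have hM : ∫ v, v * p (q₀, v) = ff q₀ * m q₀ := by
    rw [hm0]; field_simp
  have hq00 : q 0 = q₀ := by rw [hq, hq₀]; simp
  have hF0 : μ.real {ω | f ω ≤ q₀} = 1 - α := by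
    have := hlevel 0 ⟨le_rfl, hε₀.le⟩
    simpa [hq00, Measure.real] using this
  have hmain := qs_main μ f g hf hg p hp_meas hp_nonneg hdensity hg_nonneg q₀ η hη hp_cont B
    hB_int hB q hq_tendsto
  have htail := qs_tail μ g hg hg_int (η / 2) (half_pos hη)
  have hup := hmain.add htail
  rw [add_zero] at hup
  -- the increment of the CDF
  have hD : Tendsto (fun ε : ℝ => (μ.real {ω | f ω ≤ q₀} - μ.real {ω | f ω ≤ q ε}) / ε)
      (𝓝[>] 0) (𝓝 (ff q₀ * m q₀)) := by
    rw [← hM]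
    have hev : ∀ᶠ ε : ℝ in 𝓝[>] 0, 0 < ε ∧
        μ.real {ω | f ω ≤ q₀} - μ.real {ω | f ω ≤ q ε}
          = μ.real {ω | q ε < f ω ∧ f ω ≤ q ε + ε * g ω} := by
      filter_upwards [Ioc_mem_nhdsGT hε₀] with ε hε
      refine ⟨hε.1, ?_⟩
      have hl : μ.real {ω | f ω - ε * g ω ≤ q ε} = 1 - α := hlevel ε ⟨hε.1.le, hε.2⟩
      have hms : MeasurableSet {ω | q ε < f ω ∧ f ω ≤ q ε + ε * g ω} :=
        (measurableSet_lt measurable_const hf).inter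
          (measurableSet_le hf ((hg.const_mul ε).const_add _))
      have hdis : Disjoint {ω | f ω ≤ q ε} {ω | q ε < f ω ∧ f ω ≤ q ε + ε * g ω} := by
        rw [Set.disjoint_left]
        intro ω h1 h2
        exact absurd h2.1 (not_lt.2 h1)
      have hun := measureReal_union (μ := μ) hdis hms
      have hae : μ.real {ω | f ω - ε * g ω ≤ q ε}
          = μ.real ({ω | f ω ≤ q ε} ∪ {ω | q ε < f ω ∧ f ω ≤ q ε + ε * g ω}) := by
        refine measureReal_congr ?_
        filter_upwards [hg_nonneg] with ω hω
        have h0 : 0 ≤ ε * g ω := mul_nonneg hε.1.le hω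
        refine propext ?_
        change (f ω - ε * g ω ≤ q ε) ↔ (f ω ≤ q ε ∨ (q ε < f ω ∧ f ω ≤ q ε + ε * g ω))
        constructor
        · intro h
          rcases le_or_gt (f ω) (q ε) with h' | h'
          · exact Or.inl h'
          · exact Or.inr ⟨h', by linarith⟩
        · rintro (h | h)
          · linarith
          · linarith [h.2]
      linarith
    refine tendsto_of_tendsto_of_tendsto_of_le_of_le' hmain hup ?_ ?_
    · filter_upwards [hev] with ε hε
      have := hε.1
      rw [hε.2]
      refine div_le_div_of_nonneg_right (measureReal_mono ?_) hε.1.le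
      exact fun ω h => ⟨h.1, h.2.1⟩
    · filter_upwards [hev] with ε hε
      rw [hε.2, ← add_div]
      refine div_le_div_of_nonneg_right ((measureReal_mono ?_).trans (measureReal_union_le _ _))
        hε.1.le
      intro ω h
      rcases le_or_gt (ε * g ω) (η / 2) with h' | h'
      · exact Or.inl ⟨h.1, h.2, h'⟩
      · exact Or.inr h'
  have hne : ∀ᶠ ε : ℝ in 𝓝[>] 0, ε ≠ 0 := by
    filter_upwards [self_mem_nhdsWithin] with ε hε
    exact ne_of_gt hε
  have hDo : (fun ε : ℝ => μ.real {ω | f ω ≤ q₀} - μ.real {ω | f ω ≤ q ε}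
      - ε * (ff q₀ * m q₀)) =o[𝓝[>] 0] fun ε : ℝ => ε := by
    refine (isLittleO_iff_tendsto' (hne.mono fun ε h h' => absurd h' h)).2 ?_
    have := hD.sub_const (ff q₀ * m q₀)
    rw [sub_self] at this
    refine this.congr' ?_
    filter_upwards [hne] with ε hε
    field_simp
  have hDO : (fun ε : ℝ => μ.real {ω | f ω ≤ q ε} - μ.real {ω | f ω ≤ q₀})
      =O[𝓝[>] 0] fun ε : ℝ => ε := by
    have h1 : (fun ε : ℝ => ε * (ff q₀ * m q₀)) =O[𝓝[>] 0] fun ε : ℝ => ε := by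
      refine IsBigO.of_bound |ff q₀ * m q₀| (Eventually.of_forall fun ε => ?_)
      rw [norm_mul, mul_comm]; rfl
    refine (hDo.isBigO.add h1).neg_left.congr_left fun ε => ?_
    ring
  have hlin : (fun x => μ.real {ω | f ω ≤ x} - μ.real {ω | f ω ≤ q₀} - (x - q₀) * ff q₀)
      =o[𝓝 q₀] fun x => x - q₀ := by
    simpa [Measure.real] using hcdf_deriv.isLittleO
  have hrev : (fun x => x - q₀) =O[𝓝 q₀]
      fun x => μ.real {ω | f ω ≤ x} - μ.real {ω | f ω ≤ q₀} := by
    have h1 : (fun x => x - q₀) =O[𝓝 q₀] fun x => (x - q₀) * ff q₀ := by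
      refine IsBigO.of_bound (ff q₀)⁻¹ (Eventually.of_forall fun x => ?_)
      rw [norm_mul, Real.norm_of_nonneg hff_pos.le]
      field_simp; rfl
    have h2 := (hlin.trans_isBigO h1).right_isBigO_add
    refine h1.trans (h2.congr_right fun x => ?_)
    ring
  have hqO : (fun ε => q ε - q₀) =O[𝓝[>] 0] fun ε : ℝ => ε :=
    (hrev.comp_tendsto hq_tendsto).trans hDO
  have hlq : (fun ε => μ.real {ω | f ω ≤ q ε} - μ.real {ω | f ω ≤ q₀} - (q ε - q₀) * ff q₀)
      =o[𝓝[>] 0] fun ε : ℝ => ε :=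
    (hlin.comp_tendsto hq_tendsto).trans_isBigO hqO
  refine ((hDo.add hlq).const_mul_left (-(ff q₀)⁻¹)).congr_left fun ε => ?_
  field_simp
  ring
end

section
/- Let (f,g) be a random vector in ℝ² on a probability space with a joint density p(u,v) with respect to Lebesgue measure, with g ≥ 0 almost surely and E[g] < ∞. Fix x ∈ ℝ. Assume p is continuous on a neighborhood of {x} × ℝ and that there exist η > 0 with ∫_ℝ sup_{|s−x|≤η} (1+|v|)·p(s,v) dv < ∞. Then the map ε ↦ P(f − εg ≤ x) is differentiable at ε = 0 and its derivative there equals ∫_ℝ v·p(x,v) dv; in particular, writing f_f for the marginal density of f and m(x) := (1/f_f(x)) ∫_ℝ v·p(x,v) dv when f_f(x) > 0, this derivative equals f_f(x)·m(x). -/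
open MeasureTheory Set

open Filter Topology

/-- indicator difference -/
noncomputable def hdiff (x ε : ℝ) (q : ℝ × ℝ) : ℝ :=
  {q : ℝ × ℝ | q.1 - ε * q.2 ≤ x}.indicator (fun _ => (1 : ℝ)) q
    - {q : ℝ × ℝ | q.1 ≤ x}.indicator (fun _ => (1 : ℝ)) q

lemma hdiff_meas (x ε : ℝ) : Measurable (hdiff x ε) := by
  unfold hdiff
  refine (measurable_const.indicator ?_).sub (measurable_const.indicator ?_)
  · exact measurableSet_le (by fun_prop) (by fun_prop)
  · exact measurableSet_le (by fun_prop) (by fun_prop)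

lemma hdiff_bound (x ε : ℝ) (q : ℝ × ℝ) : |hdiff x ε q| ≤ 1 := by
  unfold hdiff
  simp only [indicator_apply]
  split_ifs <;> simp

lemma hdiff_inner (x ε v : ℝ) (r : ℝ → ℝ) :
    ∫ u, r u * hdiff x ε (u, v) = ∫ u in x..(x + ε * v), r u := by
  rcases le_total 0 (ε * v) with h | h
  · rw [intervalIntegral.integral_of_le (by linarith), ← integral_indicator measurableSet_Ioc]
    congr 1
    ext u
    simp only [hdiff, indicator_apply, mem_ofPred_eq, mem_Ioc]
    split_ifs <;> grind
  · rw [intervalIntegral.integral_of_ge (by linarith), ← integral_indicator measurableSet_Ioc,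
      ← integral_neg]
    congr 1
    ext u
    simp only [hdiff, indicator_apply, mem_ofPred_eq, mem_Ioc]
    split_ifs <;> grind

lemma cutset_meas (ε η : ℝ) : MeasurableSet {q : ℝ × ℝ | |ε * q.2| ≤ η} :=
  measurableSet_le (by fun_prop) (by fun_prop)

lemma density_integral {Ω : Type*} [MeasurableSpace Ω] (μ : Measure Ω)
    [IsProbabilityMeasure μ] (f g : Ω → ℝ) (hf : Measurable f) (hg : Measurable g)
    (p : ℝ × ℝ → ℝ) (hp_meas : Measurable p) (hp_nonneg : ∀ uv, 0 ≤ p uv)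
    (hdensity : Measure.map (fun ω => (f ω, g ω)) μ =
      (volume : Measure (ℝ × ℝ)).withDensity fun uv => ENNReal.ofReal (p uv))
    (k : ℝ × ℝ → ℝ) (hk : Measurable k) (hk1 : ∀ q, |k q| ≤ 1) :
    ∫ ω, k (f ω, g ω) ∂μ = ∫ v, ∫ u, p (u, v) * k (u, v) := by
  have hfg : Measurable (fun ω => (f ω, g ω)) := hf.prodMk hg
  have hpm : Measurable fun uv => ENNReal.ofReal (p uv) := hp_meas.ennreal_ofReal
  have hlt : ∀ᵐ uv ∂(volume : Measure (ℝ × ℝ)), ENNReal.ofReal (p uv) < ⊤ :=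
    Eventually.of_forall fun _ => ENNReal.ofReal_lt_top
  have hint : Integrable k (Measure.map (fun ω => (f ω, g ω)) μ) := by
    have := Measure.isProbabilityMeasure_map (μ := μ) hfg.aemeasurable
    exact Integrable.of_bound hk.aestronglyMeasurable 1 (Eventually.of_forall hk1)
  have e1 : ∫ ω, k (f ω, g ω) ∂μ = ∫ q, k q ∂(Measure.map (fun ω => (f ω, g ω)) μ) :=
    (integral_map hfg.aemeasurable hk.aestronglyMeasurable).symm
  rw [hdensity] at hint e1
  rw [integrable_withDensity_iff_integrable_smul' hpm hlt] at hint
  rw [e1, integral_withDensity_eq_integral_toReal_smul hpm hlt]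
  simp only [ENNReal.toReal_ofReal (hp_nonneg _), smul_eq_mul] at hint ⊢
  rw [Measure.volume_eq_prod] at hint ⊢
  exact integral_prod_symm _ hint

/-- Derivative of the perturbed CDF (equation (derivative-cdf) in the proof of Lemma 1 of the
paper): if `(f, g)` has joint Lebesgue density `p`, with `g ≥ 0` a.s. and `E[g] < ∞`, `p`
continuous near `{x} × ℝ` and locally dominated by an integrable bound, then
`ε ↦ P(f − εg ≤ x)` is differentiable at `ε = 0` with derivative `∫ v, v·p(x,v) dv`;
in particular, whenever the marginal density `f_f(x) = ∫ v, p(x,v) dv` is positive, this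
derivative equals `f_f(x)·m(x)` with `m(x) := (1/f_f(x))·∫ v, v·p(x,v) dv`. -/
theorem perturbed_cdf_hasDerivAt {Ω : Type*} [MeasurableSpace Ω] (μ : Measure Ω)
    [IsProbabilityMeasure μ] (f g : Ω → ℝ) (hf : Measurable f) (hg : Measurable g)
    (p : ℝ × ℝ → ℝ) (hp_meas : Measurable p) (hp_nonneg : ∀ uv, 0 ≤ p uv)
    (hdensity : Measure.map (fun ω => (f ω, g ω)) μ =
      (volume : Measure (ℝ × ℝ)).withDensity fun uv => ENNReal.ofReal (p uv))
    (hg_nonneg : ∀ᵐ ω ∂μ, 0 ≤ g ω) (hg_int : Integrable g μ)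
    (x : ℝ) (η : ℝ) (hη : 0 < η)
    (hp_cont : ContinuousOn p (Icc (x - η) (x + η) ×ˢ (univ : Set ℝ)))
    (B : ℝ → ℝ) (hB_int : Integrable B)
    (hB : ∀ s : ℝ, |s - x| ≤ η → ∀ v : ℝ, (1 + |v|) * p (s, v) ≤ B v) :
    HasDerivAt (fun ε : ℝ => (μ {ω | f ω - ε * g ω ≤ x}).toReal) (∫ v, v * p (x, v)) 0 ∧
      (0 < ∫ v, p (x, v) →
        ∫ v, v * p (x, v) = (∫ v, p (x, v)) * ((∫ v, v * p (x, v)) / ∫ v, p (x, v))) := by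
  refine ⟨?_, fun h => by field_simp⟩
  have hfg : Measurable (fun ω => (f ω, g ω)) := hf.prodMk hg
  set S : ℝ → Set (ℝ × ℝ) := fun ε => {q : ℝ × ℝ | |ε * q.2| ≤ η} with hS
  have hSm : ∀ ε, MeasurableSet (S ε) := fun ε => cutset_meas ε η
  have hind1 : ∀ ε q, |(S ε).indicator (hdiff x ε) q| ≤ 1 := by
    intro ε q
    by_cases h : q ∈ S ε
    · simpa [h] using hdiff_bound x ε q
    · simp [h]
  have hind2 : ∀ ε q, |(S ε)ᶜ.indicator (hdiff x ε) q| ≤ 1 := by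
    intro ε q
    by_cases h : q ∈ (S ε)ᶜ
    · rw [indicator_of_mem h]; exact hdiff_bound x ε q
    · rw [indicator_of_notMem h]; simp
  have hm1 : ∀ ε, Measurable ((S ε).indicator (hdiff x ε)) :=
    fun ε => (hdiff_meas x ε).indicator (hSm ε)
  have hm2 : ∀ ε, Measurable ((S ε)ᶜ.indicator (hdiff x ε)) :=
    fun ε => (hdiff_meas x ε).indicator (hSm ε).compl
  have hsplit : ∀ ε : ℝ, (μ {ω | f ω - ε * g ω ≤ x}).toReal - (μ {ω | f ω - 0 * g ω ≤ x}).toReal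
      = ∫ ω, (S ε).indicator (hdiff x ε) (f ω, g ω) ∂μ
        + ∫ ω, (S ε)ᶜ.indicator (hdiff x ε) (f ω, g ω) ∂μ := by
    intro ε
    have ms : ∀ ε : ℝ, MeasurableSet {ω | f ω - ε * g ω ≤ x} := fun ε =>
      measurableSet_le (by fun_prop) (by fun_prop)
    have ei : ∀ ε : ℝ, (μ {ω | f ω - ε * g ω ≤ x}).toReal
        = ∫ ω, {ω | f ω - ε * g ω ≤ x}.indicator (fun _ => (1 : ℝ)) ω ∂μ := by
      intro ε
      rw [integral_indicator_const _ (ms ε)]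
      simp [Measure.real]
    rw [ei, ei, ← integral_sub ((integrable_const _).indicator (ms ε))
      ((integrable_const _).indicator (ms 0)), ← integral_add]
    · congr 1
      ext ω
      have := congrFun (indicator_self_add_compl (S ε) (hdiff x ε)) (f ω, g ω)
      simp only [Pi.add_apply] at this
      rw [this]
      simp [hdiff, indicator_apply]
    · exact Integrable.of_bound ((hm1 ε).comp hfg).aestronglyMeasurable 1
        (Eventually.of_forall fun ω => hind1 ε _)
    · exact Integrable.of_bound ((hm2 ε).comp hfg).aestronglyMeasurable 1
        (Eventually.of_forall fun ω => hind2 ε _)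
  have hsmall : ∀ v : ℝ, ∀ᶠ ε in 𝓝[≠] (0 : ℝ), |ε * v| ≤ η := by
    intro v
    have : Tendsto (fun ε : ℝ => |ε * v|) (𝓝[≠] 0) (𝓝 0) := by
      have hc : Continuous fun ε : ℝ => |ε * v| := by fun_prop
      have := hc.tendsto 0
      simp only [zero_mul, abs_zero] at this
      exact this.mono_left nhdsWithin_le_nhds
    exact (this.eventually_lt_const hη).mono fun _ h => h.le
  have hne : ∀ᶠ ε in 𝓝[≠] (0 : ℝ), ε ≠ 0 := eventually_mem_nhdsWithin
  have hA : Tendsto (fun ε : ℝ => ∫ ω, ε⁻¹ * (S ε)ᶜ.indicator (hdiff x ε) (f ω, g ω) ∂μ)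
      (𝓝[≠] 0) (𝓝 0) := by
    suffices h0 : Tendsto (fun ε : ℝ => ∫ ω, ε⁻¹ * (S ε)ᶜ.indicator (hdiff x ε) (f ω, g ω) ∂μ)
        (𝓝[≠] 0) (𝓝 (∫ ω, (0 : ℝ) ∂μ)) by simpa only [integral_zero] using h0
    refine tendsto_integral_filter_of_dominated_convergence (fun ω => |g ω| / η) ?_ ?_ ?_ ?_
    · exact Eventually.of_forall fun ε =>
        (((hm2 ε).comp hfg).const_mul ε⁻¹).aestronglyMeasurable
    · filter_upwards [hne] with ε hε
      refine Eventually.of_forall fun ω => ?_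
      by_cases h : (f ω, g ω) ∈ (S ε)ᶜ
      · have h' : η < |ε| * |g ω| := by
          rw [← abs_mul]; simpa [hS] using h
        have hε' : 0 < |ε| := abs_pos.mpr hε
        rw [Real.norm_eq_abs, abs_mul, abs_inv]
        calc |ε|⁻¹ * |(S ε)ᶜ.indicator (hdiff x ε) (f ω, g ω)| ≤ |ε|⁻¹ * 1 := by
              gcongr; exact hind2 _ _
          _ ≤ |g ω| / η := by
              rw [mul_one, le_div_iff₀ hη, inv_mul_le_iff₀ hε']
              exact h'.le
      · rw [indicator_of_notMem h]
        simp only [mul_zero, norm_zero]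
        positivity
    · exact hg_int.abs.div_const η
    · refine Eventually.of_forall fun ω => ?_
      refine tendsto_const_nhds.congr' ?_
      filter_upwards [hsmall (g ω)] with ε hε
      rw [indicator_of_notMem]
      · simp
      · simpa [hS] using hε
  have hBr : ∀ ε, ∫ ω, (S ε).indicator (hdiff x ε) (f ω, g ω) ∂μ
      = ∫ v, if |ε * v| ≤ η then ∫ u in x..(x + ε * v), p (u, v) else 0 := by
    intro ε
    rw [density_integral μ f g hf hg p hp_meas hp_nonneg hdensity _ (hm1 ε) (hind1 ε)]
    congr 1
    ext v
    split_ifs with h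
    · rw [← hdiff_inner]
      congr 1
      ext u
      rw [indicator_of_mem]
      exact h
    · rw [← integral_zero ℝ ℝ]
      congr 1
      ext u
      rw [indicator_of_notMem, mul_zero]
      exact h
  have hBm : ∀ ε, AEStronglyMeasurable
      (fun v => if |ε * v| ≤ η then ∫ u in x..(x + ε * v), p (u, v) else 0) volume := by
    intro ε
    have : StronglyMeasurable (fun v => ∫ u, p (u, v) * hdiff x ε (u, v)) := by
      apply StronglyMeasurable.integral_prod_left
      exact (hp_meas.mul (hdiff_meas x ε)).stronglyMeasurable
    simp only [hdiff_inner x ε _ (fun u => p (u, _))] at this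
    exact (Measurable.ite (measurableSet_le (by fun_prop) (by fun_prop)) this.measurable
      measurable_const).aestronglyMeasurable
  have hB' : Tendsto (fun ε : ℝ => ∫ v, ε⁻¹ *
      (if |ε * v| ≤ η then ∫ u in x..(x + ε * v), p (u, v) else 0))
      (𝓝[≠] 0) (𝓝 (∫ v, v * p (x, v))) := by
    refine tendsto_integral_filter_of_dominated_convergence B ?_ ?_ hB_int ?_
    · exact Eventually.of_forall fun ε => (hBm ε).const_mul _
    · filter_upwards [hne] with ε hε
      refine Eventually.of_forall fun v => ?_
      have hBv : 0 ≤ B v := le_trans (mul_nonneg (by positivity) (hp_nonneg (x, v)))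
        (hB x (by simpa using hη.le) v)
      split_ifs with h
      · have hε' : 0 < |ε| := abs_pos.mpr hε
        have hb : ‖∫ u in x..(x + ε * v), p (u, v)‖ ≤ B v / (1 + |v|) * |x + ε * v - x| := by
          apply intervalIntegral.norm_integral_le_of_norm_le_const
          intro u hu
          rw [Real.norm_eq_abs, abs_of_nonneg (hp_nonneg _), le_div_iff₀ (by positivity), mul_comm]
          apply hB
          have := abs_sub_left_of_mem_uIcc (uIoc_subset_uIcc hu)
          refine this.trans ?_
          simpa using h
        rw [norm_mul, norm_inv, Real.norm_eq_abs ε, inv_mul_le_iff₀ hε']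
        refine hb.trans ?_
        rw [add_sub_cancel_left, abs_mul, div_mul_eq_mul_div, div_le_iff₀ (by positivity)]
        have := mul_nonneg hε'.le hBv
        nlinarith
      · simpa using hBv
    · refine Eventually.of_forall fun v => ?_
      have hc : ContinuousOn (fun u => p (u, v)) (Icc (x - η) (x + η)) :=
        hp_cont.comp (by fun_prop) (fun u hu => ⟨hu, mem_univ _⟩)
      have hn : Icc (x - η) (x + η) ∈ 𝓝 x := Icc_mem_nhds (by linarith) (by linarith)
      have hd : HasDerivAt (fun b => ∫ u in x..b, p (u, v)) (p (x, v)) x := by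
        apply intervalIntegral.integral_hasDerivAt_right
        · simp
        · exact (hp_meas.comp (by fun_prop : Measurable fun u : ℝ => (u, v))).stronglyMeasurable.stronglyMeasurableAtFilter
        · exact hc.continuousAt hn
      have hl : HasDerivAt (fun ε : ℝ => x + ε * v) v 0 := by
        simpa using ((hasDerivAt_id (0 : ℝ)).mul_const v).const_add x
      have hd2 : HasDerivAt (fun ε : ℝ => ∫ u in x..(x + ε * v), p (u, v)) (p (x, v) * v) 0 := by
        have hd' : HasDerivAt (fun b => ∫ u in x..b, p (u, v)) (p (x, v)) (x + 0 * v) := by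
          simpa using hd
        exact hd'.comp (0 : ℝ) hl
      rw [hasDerivAt_iff_tendsto_slope_zero] at hd2
      rw [mul_comm v]
      refine hd2.congr' ?_
      filter_upwards [hsmall v] with ε hε
      rw [if_pos hε]
      simp
  rw [hasDerivAt_iff_tendsto_slope_zero]
  have := hB'.add hA
  rw [add_zero] at this
  refine this.congr fun ε => ?_
  rw [zero_add, hsplit, hBr, integral_const_mul, integral_const_mul, smul_eq_mul, mul_add]
end

section
/- Let α ∈ (0,1) and e ≥ 0. Let V be a real random variable (the model's predictive probability f_{y_test}(x_test) for the true test label) whose law has a density g with respect to Lebesgue measure, with g continuously differentiable on a neighborhood of a point q₀ ∈ ℝ (the (1−α)-quantile of the attacked calibration scores). Assume the clean-threshold coverage satisfies |P(V ≥ q₀) − (1−α)| ≤ e. Let G ≥ 0 (representing the gradient norm ‖∇f_{x_test}‖) and c ∈ ℝ (representing the conditional mean gradient norm at the quantile) be constants, and for ε_cal, ε_test ≥ 0 define the threshold shift δ(ε_cal, ε_test) := (2ε_test − ε_cal)·G − ε_cal·c. Then there exist constants C > 0 and r > 0 such that for all ε_cal, ε_test ∈ [0, r], |P(V ≥ q₀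 + δ(ε_cal, ε_test)) − (1−α)| ≤ e + |δ(ε_cal, ε_test)|·g(q₀) + C·(ε_cal² + ε_test²). -/
open MeasureTheory Set

theorem coverage_aux {Ω : Type*} [MeasurableSpace Ω] (μ : Measure Ω)
    [IsProbabilityMeasure μ] (V : Ω → ℝ) (hV : Measurable V) (g : ℝ → ℝ)
    (hdensity : Measure.map V μ = (volume : Measure ℝ).withDensity fun v => ENNReal.ofReal (g v))
    (a b M : ℝ) (hab : a ≤ b) (hM : 0 ≤ M) (h : ∀ v ∈ Ico a b, g v ≤ M) :
    |(μ {ω | a ≤ V ω}).toReal - (μ {ω | b ≤ V ω}).toReal| ≤ M * (b - a) := by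
  have h1 : μ (V ⁻¹' Ico a b) ≤ ENNReal.ofReal (M * (b - a)) := by
    rw [← Measure.map_apply hV measurableSet_Ico, hdensity, withDensity_apply _ measurableSet_Ico]
    calc ∫⁻ v in Ico a b, ENNReal.ofReal (g v)
        ≤ ∫⁻ v in Ico a b, ENNReal.ofReal M :=
          setLIntegral_mono' measurableSet_Ico fun v hv => ENNReal.ofReal_le_ofReal (h v hv)
      _ = ENNReal.ofReal (M * (b - a)) := by
          rw [setLIntegral_const, Real.volume_Ico, ENNReal.ofReal_mul hM]
  have h2 : μ.real (V ⁻¹' Ico a b) ≤ M * (b - a) :=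
    ENNReal.toReal_le_of_le_ofReal (mul_nonneg hM (by linarith)) h1
  have h3 : μ.real {ω | a ≤ V ω} ≤ μ.real (V ⁻¹' Ico a b) + μ.real {ω | b ≤ V ω} := by
    refine le_trans (measureReal_mono ?_) (measureReal_union_le _ _)
    intro ω hω
    rcases lt_or_ge (V ω) b with hb | hb
    · exact Or.inl ⟨hω, hb⟩
    · exact Or.inr hb
  have h4 : μ.real {ω | b ≤ V ω} ≤ μ.real {ω | a ≤ V ω} :=
    measureReal_mono fun ω hω => le_trans hab hω
  change |μ.real {ω | a ≤ V ω} - μ.real {ω | b ≤ V ω}| ≤ _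
  rw [abs_of_nonneg (by linarith)]
  linarith

/-- Analytic core of Theorem 1 of the paper: `V` is the model's predictive probability for the
true test label, with Lebesgue density `g` continuously differentiable near the attacked
calibration quantile `q₀`; if the clean-threshold coverage satisfies
`|P(V ≥ q₀) − (1−α)| ≤ e`, then with the first-order threshold shift
`δ(ε_cal, ε_test) := (2ε_test − ε_cal)·G − ε_cal·c`, the coverage under attacks satisfies
`|P(V ≥ q₀ + δ) − (1−α)| ≤ e + |δ|·g(q₀) + C·(ε_cal² + ε_test²)` for some `C > 0`
uniformly over small `ε_cal, ε_test ≥ 0`. -/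
theorem coverage_shift_bound {Ω : Type*} [MeasurableSpace Ω] (μ : Measure Ω)
    [IsProbabilityMeasure μ] (α : ℝ) (hα : α ∈ Ioo (0 : ℝ) 1) (e : ℝ) (he : 0 ≤ e)
    (V : Ω → ℝ) (hV : Measurable V)
    (g : ℝ → ℝ) (hg_nonneg : ∀ v, 0 ≤ g v)
    (hdensity : Measure.map V μ = (volume : Measure ℝ).withDensity fun v => ENNReal.ofReal (g v))
    (q₀ : ℝ) (s : Set ℝ) (hs : s ∈ nhds q₀) (hg_smooth : ContDiffOn ℝ 1 g s)
    (hclean : |(μ {ω | q₀ ≤ V ω}).toReal - (1 - α)| ≤ e)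
    (G : ℝ) (hG : 0 ≤ G) (c : ℝ)
    (δ : ℝ → ℝ → ℝ) (hδ : ∀ εcal εtest : ℝ, δ εcal εtest = (2 * εtest - εcal) * G - εcal * c) :
    ∃ C > (0 : ℝ), ∃ r > (0 : ℝ), ∀ εcal ∈ Icc (0 : ℝ) r, ∀ εtest ∈ Icc (0 : ℝ) r,
      |(μ {ω | q₀ + δ εcal εtest ≤ V ω}).toReal - (1 - α)| ≤
        e + |δ εcal εtest| * g q₀ + C * (εcal ^ 2 + εtest ^ 2) := by
  obtain ⟨K, t, ht, hK⟩ := (hg_smooth.contDiffAt hs).exists_lipschitzOnWith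
  obtain ⟨R, hR, hRt⟩ := Metric.mem_nhds_iff.1 ht
  have hc := abs_nonneg c
  obtain ⟨L, hL⟩ : ∃ L, L = 2 * G + |c| + 1 := ⟨_, rfl⟩
  have hLpos : 0 < L := by rw [hL]; positivity
  have hKnn : (0 : ℝ) ≤ K := K.2
  refine ⟨2 * K * L ^ 2 + 1, by positivity, R / (4 * L), by positivity, ?_⟩
  rintro x ⟨hx0, hxr⟩ y ⟨hy0, hyr⟩
  have hd := hδ x y
  generalize δ x y = d at hd
  have hdL : |d| ≤ L * (x + y) := by
    rw [hd, hL, abs_le]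
    have h1 := mul_nonneg hx0 hG
    have h2 := mul_nonneg hy0 hG
    have h3 := mul_nonneg hy0 hc
    have h4 := mul_le_mul_of_nonneg_left (le_abs_self c) hx0
    have h5 := mul_le_mul_of_nonneg_left (neg_abs_le c) hx0
    constructor <;> nlinarith
  have hdR : |d| < R := by
    rw [le_div_iff₀ (by positivity)] at hxr hyr
    nlinarith
  have hd2 : |d| ^ 2 ≤ 2 * L ^ 2 * (x ^ 2 + y ^ 2) := by
    have : |d| ^ 2 ≤ (L * (x + y)) ^ 2 := by gcongr
    nlinarith [mul_nonneg (sq_nonneg L) (sq_nonneg (x - y))]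
  have hb : ∀ v, |v - q₀| ≤ |d| → g v ≤ g q₀ + K * |d| := by
    intro v hv
    have h1 := hK.dist_le_mul v (hRt (by rw [Metric.mem_ball, Real.dist_eq]; linarith)) q₀
      (mem_of_mem_nhds ht)
    rw [Real.dist_eq, Real.dist_eq] at h1
    have h2 := mul_le_mul_of_nonneg_left hv hKnn
    have h3 := le_abs_self (g v - g q₀)
    linarith
  have hM : 0 ≤ g q₀ + K * |d| := add_nonneg (hg_nonneg _) (by positivity)
  have key : |(μ {ω | q₀ + d ≤ V ω}).toReal - (μ {ω | q₀ ≤ V ω}).toReal|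
      ≤ (g q₀ + K * |d|) * |d| := by
    rcases le_total 0 d with h | h
    · rw [abs_sub_comm]
      refine (coverage_aux μ V hV g hdensity q₀ (q₀ + d) _ (by linarith) hM ?_).trans
        (le_of_eq ?_)
      · rintro v ⟨h1, h2⟩
        apply hb
        rw [abs_of_nonneg h, abs_le]; constructor <;> linarith
      · rw [abs_of_nonneg h]; ring
    · refine (coverage_aux μ V hV g hdensity (q₀ + d) q₀ _ (by linarith) hM ?_).trans
        (le_of_eq ?_)
      · rintro v ⟨h1, h2⟩
        apply hb
        rw [abs_of_nonpos h, abs_le]; constructor <;> linarith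
      · rw [abs_of_nonpos h]; ring
  have tri := abs_sub_le (μ {ω | q₀ + d ≤ V ω}).toReal (μ {ω | q₀ ≤ V ω}).toReal (1 - α)
  have h6 := mul_le_mul_of_nonneg_left hd2 hKnn
  nlinarith [sq_nonneg x, sq_nonneg y]
end

section
/- Let K ≥ 3 be an integer, α ∈ (0,1), h ≥ 0, and let Q ∈ (0,1) and P_true ∈ (0,1) satisfy 0 ≤ 1 − Q ≤ 1 − P_true. Let (f_1, …, f_K) be a random vector of real random variables on a probability space (the classifier's predictive probabilities at the test point) and let y* ∈ {1,…,K} be a fixed index (the true label). Define the prediction-set size |C| := Σ_{y=1}^K 1{f_y ≥ 1 − Q}. Assume: (i) P(f_{y*} ≥ 1 − Q) ≤ 1 − α + h; and (ii) for each y ≠ y*, the law of f_y/(1 − P_true) is the Beta distribution Beta(1, K−2). Then E[|C|] ≤ 1 − α + h + (K−1)·(1 − (1−Q)/(1−P_true))^{K−2}. -/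
open MeasureTheory Set

/-- The Beta distribution `Beta(1, n)`: the Borel probability measure on `ℝ` supported
on `[0,1]` with density `v ↦ n·(1−v)^(n−1)·1_{[0,1]}(v)` with respect to Lebesgue measure. -/
noncomputable def betaOne (n : ℕ) : Measure ℝ :=
  (volume : Measure ℝ).withDensity fun v =>
    ENNReal.ofReal (if v ∈ Icc (0 : ℝ) 1 then (n : ℝ) * (1 - v) ^ (n - 1) else 0)

lemma betaOne_Ici (n : ℕ) (hn : 1 ≤ n) (t : ℝ) (h0 : 0 ≤ t) (h1 : t ≤ 1) :
    betaOne n (Ici t) = ENNReal.ofReal ((1 - t) ^ n) := by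
  have e : ∀ v : ℝ, (Ici t).indicator (fun v : ℝ =>
      ENNReal.ofReal (if v ∈ Icc (0 : ℝ) 1 then (n : ℝ) * (1 - v) ^ (n - 1) else 0)) v =
      (Icc t 1).indicator (fun v : ℝ => ENNReal.ofReal ((n : ℝ) * (1 - v) ^ (n - 1))) v := by
    intro v
    by_cases ht : t ≤ v
    · by_cases hv : v ≤ 1
      · simp [indicator, ht, hv, h0.trans ht]
      · simp [indicator, ht, hv]
    · simp [indicator, ht]
  have hc : Continuous (fun v : ℝ => (n : ℝ) * (1 - v) ^ (n - 1)) := by fun_prop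
  rw [betaOne, withDensity_apply _ measurableSet_Ici, ← lintegral_indicator measurableSet_Ici,
    lintegral_congr e, lintegral_indicator measurableSet_Icc,
    ← ofReal_integral_eq_lintegral_ofReal (hc.integrableOn_Icc)]
  · congr 1
    rw [integral_Icc_eq_integral_Ioc, ← intervalIntegral.integral_of_le h1]
    have hd : ∀ x ∈ uIcc t 1, HasDerivAt (fun v : ℝ => -(1 - v) ^ n)
        ((n : ℝ) * (1 - x) ^ (n - 1)) x := by
      intro x _
      have h2 : HasDerivAt (fun v : ℝ => 1 - v) (-1) x := (hasDerivAt_id x).const_sub 1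
      have h3 := (h2.fun_pow n).fun_neg
      have h4 : -((n : ℝ) * (1 - x) ^ (n - 1) * -1) = (n : ℝ) * (1 - x) ^ (n - 1) := by ring
      rwa [h4] at h3
    rw [intervalIntegral.integral_eq_sub_of_hasDerivAt hd (hc.intervalIntegrable _ _)]
    simp [show n ≠ 0 by omega]
  · filter_upwards [ae_restrict_mem measurableSet_Icc] with v hv
    have : 0 ≤ 1 - v := by linarith [hv.2]
    simp only [Pi.zero_apply]
    positivity

/-- Expected prediction-set-size bound (Theorem 3 of the paper): if the true class is covered
with probability at most `1 − α + h`, and each rescaled incorrect-class probability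
`f_y/(1 − P_true)` has law `Beta(1, K−2)`, then the expected size of the split conformal
prediction set `C = {y : f_y ≥ 1 − Q}` satisfies
`E[|C|] ≤ 1 − α + h + (K−1)·(1 − (1−Q)/(1−P_true))^(K−2)`. -/
theorem expected_set_size_bound {Ω : Type*} [MeasurableSpace Ω] (μ : Measure Ω)
    [IsProbabilityMeasure μ] (K : ℕ) (hK : 3 ≤ K) (α : ℝ) (hα : α ∈ Ioo (0 : ℝ) 1)
    (h : ℝ) (hh : 0 ≤ h) (Q Ptrue : ℝ) (hQ : Q ∈ Ioo (0 : ℝ) 1) (hP : Ptrue ∈ Ioo (0 : ℝ) 1)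
    (hQP : 1 - Q ≤ 1 - Ptrue)
    (f : Fin K → Ω → ℝ) (hf : ∀ y, Measurable (f y)) (ystar : Fin K)
    (hcov : (μ {ω | 1 - Q ≤ f ystar ω}).toReal ≤ 1 - α + h)
    (hbeta : ∀ y : Fin K, y ≠ ystar →
      Measure.map (fun ω => f y ω / (1 - Ptrue)) μ = betaOne (K - 2)) :
    (∫ ω, (∑ y : Fin K, if 1 - Q ≤ f y ω then (1 : ℝ) else 0) ∂μ) ≤
      1 - α + h + (K - 1 : ℝ) * (1 - (1 - Q) / (1 - Ptrue)) ^ (K - 2) := by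
  have hp : 0 < 1 - Ptrue := by linarith [hP.2]
  have hq : 0 < 1 - Q := by linarith [hQ.2]
  have hm : ∀ y, MeasurableSet {ω | 1 - Q ≤ f y ω} :=
    fun y => measurableSet_le measurable_const (hf y)
  have hind : ∀ y : Fin K, (fun ω => if 1 - Q ≤ f y ω then (1 : ℝ) else 0) =
      {ω | 1 - Q ≤ f y ω}.indicator (fun _ => (1 : ℝ)) := by
    intro y
    ext ω
    simp [indicator]
  have hint : ∀ y : Fin K, (∫ ω, (if 1 - Q ≤ f y ω then (1 : ℝ) else 0) ∂μ) =
      (μ {ω | 1 - Q ≤ f y ω}).toReal := by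
    intro y
    rw [hind y, integral_indicator (hm y)]
    simp [Measure.real]
  have hother : ∀ y : Fin K, y ≠ ystar → (μ {ω | 1 - Q ≤ f y ω}).toReal =
      (1 - (1 - Q) / (1 - Ptrue)) ^ (K - 2) := by
    intro y hy
    have ht1 : (1 - Q) / (1 - Ptrue) ≤ 1 := (div_le_one hp).2 hQP
    have hb := betaOne_Ici (K - 2) (by omega) ((1 - Q) / (1 - Ptrue)) (by positivity) ht1
    rw [← hbeta y hy, Measure.map_apply ((hf y).div_const _) measurableSet_Ici] at hb
    have hs : (fun ω => f y ω / (1 - Ptrue)) ⁻¹' Ici ((1 - Q) / (1 - Ptrue)) =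
        {ω | 1 - Q ≤ f y ω} := by
      ext ω
      simp [div_le_div_iff_of_pos_right hp]
    rw [hs] at hb
    rw [hb, ENNReal.toReal_ofReal]
    exact pow_nonneg (by linarith) _
  rw [integral_finsetSum]
  · rw [← Finset.add_sum_erase _ _ (Finset.mem_univ ystar), hint]
    rw [Finset.sum_congr rfl (fun y hy => (hint y).trans (hother y (Finset.ne_of_mem_erase hy)))]
    rw [Finset.sum_const, Finset.card_erase_of_mem (Finset.mem_univ _), Finset.card_univ,
      Fintype.card_fin, nsmul_eq_mul, Nat.cast_sub (by omega), Nat.cast_one]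
    linarith
  · intro y _
    rw [hind y]
    exact (integrable_const _).indicator (hm y)
end
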